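/- Let P have n points, let t > 0, let R ≥ t, and let M ⊆ P be a subset whose points are pairwise at distance greater than t. For each p ∈ M let C̃(p) denote the number of points q ∈ P with ‖p − q‖ ≤ R. Then Σ_{p ∈ M} C̃(p) ≤ n · λ_R^{⌈log₂(2R/t)⌉}, where λ_R is the R-restricted doubling constant of P. -/

import Mathlib

open Metric

/-- `P ∩ B(p, r)` can be covered by at most `m` closed balls of radius `r/2`,
each centered at a point of `P`. -/
def CoverCond {d : ℕ} (P : Finset (EuclideanSpace ℝ (Fin d))) (m : ℕ)
    (p : EuclideanSpace ℝ (Fin d)) (r : ℝ) : Prop :=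
  ∃ C : Finset (EuclideanSpace ℝ (Fin d)), C ⊆ P ∧ C.card ≤ m ∧
    ∀ q ∈ P, dist q p ≤ r → ∃ c ∈ C, dist q c ≤ r / 2

/-- The `t`-restricted doubling constant `λ_t` of `P`: the smallest positive integer `m`
such that for all `p ∈ P` and all radii `0 < r ≤ t`, `P ∩ B(p,r)` is covered by `m`
closed balls of radius `r/2` centered at points of `P`. -/
noncomputable def restDoublingConst {d : ℕ} (P : Finset (EuclideanSpace ℝ (Fin d)))
    (t : ℝ) : ℕ :=
  sInf {m : ℕ | 0 < m ∧ ∀ p ∈ P, ∀ r : ℝ, 0 < r → r ≤ t → CoverCond P m p r}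

lemma restDoublingConst_spec {d : ℕ} {P : Finset (EuclideanSpace ℝ (Fin d))}
    (hP : P.Nonempty) (t : ℝ) :
    ∀ p ∈ P, ∀ r : ℝ, 0 < r → r ≤ t → CoverCond P (restDoublingConst P t) p r := by
  have hne : {m : ℕ | 0 < m ∧ ∀ p ∈ P, ∀ r : ℝ, 0 < r → r ≤ t → CoverCond P m p r}.Nonempty :=
    ⟨P.card, hP.card_pos, fun p _ r hr _ =>
      ⟨P, subset_rfl, le_rfl, fun q hq _ => ⟨q, hq, by rw [dist_self]; positivity⟩⟩⟩
  exact (Nat.sInf_mem hne).2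

/-- Iterating the doubling property `k` times covers a ball of radius `R` by at most
`λ_R ^ k` balls of radius `R / 2 ^ k`. -/
lemma exists_cover_pow {d : ℕ} {P : Finset (EuclideanSpace ℝ (Fin d))}
    (hP : P.Nonempty) {R : ℝ} (hR : 0 < R) {p : EuclideanSpace ℝ (Fin d)} (hp : p ∈ P) (k : ℕ) :
    ∃ C ⊆ P, C.card ≤ restDoublingConst P R ^ k ∧
      ∀ q ∈ P, dist q p ≤ R → ∃ c ∈ C, dist q c ≤ R / 2 ^ k := by
  classical
  induction k with
  | zero => exact ⟨{p}, by simpa using hp, by simp, fun q _ h => ⟨p, by simp, by simpa using h⟩⟩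
  | succ k ih =>
    obtain ⟨C, hCP, hCcard, hC⟩ := ih
    have hcover : ∀ c ∈ C, CoverCond P (restDoublingConst P R) c (R / 2 ^ k) := fun c hc =>
      restDoublingConst_spec hP R c (hCP hc) _ (by positivity)
        (div_le_self hR.le (one_le_pow₀ one_le_two))
    choose! D hDP hDcard hD using hcover
    refine ⟨C.biUnion D, Finset.biUnion_subset.2 hDP, ?_, fun q hq hqp => ?_⟩
    · calc (C.biUnion D).card ≤ C.card * restDoublingConst P R :=
            Finset.card_biUnion_le_card_mul _ _ _ hDcard
        _ ≤ restDoublingConst P R ^ (k + 1) := by rw [pow_succ]; gcongr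
    · obtain ⟨c, hc, hqc⟩ := hC q hq hqp
      obtain ⟨e, he, hqe⟩ := hD c hc q hq hqc
      exact ⟨e, Finset.mem_biUnion.2 ⟨c, hc, he⟩, by rwa [pow_succ, ← div_div]⟩

lemma div_two_pow_ceil_logb_le {t R : ℝ} (ht : 0 < t) (hR : 0 < R) :
    R / 2 ^ ⌈Real.logb 2 (2 * R / t)⌉.toNat ≤ t / 2 := by
  have hlog : Real.logb 2 (2 * R / t) ≤ (⌈Real.logb 2 (2 * R / t)⌉.toNat : ℝ) :=
    (Int.le_ceil _).trans (by exact_mod_cast Int.self_le_toNat _)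
  rw [Real.logb_le_iff_le_rpow one_lt_two (by positivity), Real.rpow_natCast,
    div_le_iff₀ ht] at hlog
  rw [div_le_iff₀ (by positivity)]
  linarith

/-- A `t`-separated subset of `P` has at most `λ_R ^ ⌈log₂ (2R/t)⌉` points in any ball of
radius `R` centered at a point of `P`. -/
lemma card_filter_dist_le {d : ℕ} {P M : Finset (EuclideanSpace ℝ (Fin d))}
    (hP : P.Nonempty) {t R : ℝ} (ht : 0 < t) (hR : 0 < R) (hMP : M ⊆ P)
    (hsep : ∀ p₁ ∈ M, ∀ p₂ ∈ M, p₁ ≠ p₂ → t < dist p₁ p₂)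
    {q : EuclideanSpace ℝ (Fin d)} (hq : q ∈ P) :
    (M.filter (fun p => dist p q ≤ R)).card ≤
      restDoublingConst P R ^ (⌈Real.logb 2 (2 * R / t)⌉.toNat) := by
  obtain ⟨C, -, hCcard, hC⟩ := exists_cover_pow hP hR hq ⌈Real.logb 2 (2 * R / t)⌉.toNat
  have hcenter : ∀ p ∈ M.filter (fun p => dist p q ≤ R), ∃ c ∈ C, dist p c ≤ t / 2 := by
    intro p hp
    obtain ⟨hpM, hpq⟩ := Finset.mem_filter.1 hp
    obtain ⟨c, hc, hpc⟩ := hC p (hMP hpM) hpq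
    exact ⟨c, hc, hpc.trans (div_two_pow_ceil_logb_le ht hR)⟩
  choose! f hfC hf using hcenter
  refine (Finset.card_le_card_of_injOn f hfC fun a ha b hb hab => ?_).trans hCcard
  by_contra hne
  have hlt := hsep a (Finset.mem_filter.1 ha).1 b (Finset.mem_filter.1 hb).1 hne
  have hfb := hf b hb
  rw [← hab] at hfb
  linarith [dist_triangle_right a b (f a), hf a ha]

/-- If `M ⊆ P` has pairwise distances `> t` and `R ≥ t`, then the total number of
`R`-near neighbours in `P` summed over all points of `M` is at most
`n · λ_R^{⌈log₂ (2R/t)⌉}` where `n = |P|`. -/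
theorem sum_near_neighbours_bound {d : ℕ} (P M : Finset (EuclideanSpace ℝ (Fin d)))
    (hP : P.Nonempty) (t R : ℝ) (ht : 0 < t) (hR : t ≤ R)
    (hMP : M ⊆ P)
    (hsep : ∀ p₁ ∈ M, ∀ p₂ ∈ M, p₁ ≠ p₂ → t < dist p₁ p₂) :
    ∑ p ∈ M, (P.filter (fun q => dist p q ≤ R)).card ≤
      P.card * restDoublingConst P R ^ (⌈Real.logb 2 (2 * R / t)⌉.toNat) := by
  calc ∑ p ∈ M, (P.filter (fun q => dist p q ≤ R)).card
      = ∑ q ∈ P, (M.filter (fun p => dist p q ≤ R)).card :=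
        Finset.sum_card_bipartiteAbove_eq_sum_card_bipartiteBelow _
    _ ≤ P.card * restDoublingConst P R ^ (⌈Real.logb 2 (2 * R / t)⌉.toNat) :=
        Finset.sum_le_card_nsmul _ _ _ fun q hq =>
          card_filter_dist_le hP ht (ht.trans_le hR) hMP hsep hq
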